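/- arXiv:1812.03225 — 5 statements merged into one kernel-verified Lean document; each statement's English description precedes it below -/
import Mathlib

section
/- Let d ≥ 1 and let a, b ∈ ℓ¹(ℤ^d) be complex-valued with Σ_{q∈ℤ^d} a[q] = 1. Then ‖a*b − b‖_{ℓ¹(ℤ^d)} ≤ ( Σ_{k=1}^d ‖∇_k b‖_{ℓ¹(ℤ^d)} ) · Σ_{q∈ℤ^d} |q|_∞ |a[q]|, where (a*b)[q'] = Σ_{q∈ℤ^d} a[q] b[q'−q], (∇_k b)[q] = b[q+e_k] − b[q], and |q|_∞ = max{|q_1|, …, |q_d|}. -/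
open Finset
open scoped ENNReal

section TranslationVariation

variable {G V : Type*} [AddCommGroup G] [NormedAddCommGroup V]

/-- The `ℓ¹` distance between `b` and its translate by `q`. -/
noncomputable def translationVariation (b : G → V) (q : G) : ℝ≥0∞ :=
  ∑' x, ‖b (x + q) - b x‖ₑ

lemma translationVariation_zero (b : G → V) : translationVariation b 0 = 0 := by
  simp [translationVariation]

lemma translationVariation_add_le (b : G → V) (p q : G) :
    translationVariation b (p + q) ≤ translationVariation b p + translationVariation b q := by
  unfold translationVariation
  rw [add_comm (∑' x, ‖b (x + p) - b x‖ₑ),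
    ← (Equiv.addRight p).tsum_eq fun x => ‖b (x + q) - b x‖ₑ, ← ENNReal.tsum_add]
  refine ENNReal.tsum_le_tsum fun x => ?_
  rw [← sub_add_sub_cancel (b (x + (p + q))) (b (x + p)) (b x), ← add_assoc]
  exact enorm_add_le _ _

lemma translationVariation_neg (b : G → V) (q : G) :
    translationVariation b (-q) = translationVariation b q := by
  unfold translationVariation
  rw [← (Equiv.addRight q).tsum_eq fun x => ‖b (x + -q) - b x‖ₑ]
  refine tsum_congr fun x => ?_
  simp only [Equiv.coe_addRight, add_neg_cancel_right]
  exact enorm_sub_rev _ _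

lemma translationVariation_nsmul_le (b : G → V) (n : ℕ) (q : G) :
    translationVariation b (n • q) ≤ n * translationVariation b q := by
  induction n with
  | zero => simp [translationVariation_zero]
  | succ n ih =>
    rw [succ_nsmul, Nat.cast_succ, add_mul, one_mul]
    exact (translationVariation_add_le b _ _).trans (by gcongr)

lemma translationVariation_zsmul_le (b : G → V) (n : ℤ) (q : G) :
    translationVariation b (n • q) ≤ n.natAbs * translationVariation b q := by
  have h := translationVariation_nsmul_le b n.natAbs q
  rcases n.natAbs_eq with hn | hn
  · rwa [hn, natCast_zsmul, Int.natAbs_natCast]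
  · rwa [hn, neg_zsmul, natCast_zsmul, translationVariation_neg, Int.natAbs_neg,
      Int.natAbs_natCast]

lemma translationVariation_sum_le {ι : Type*} (b : G → V) (s : Finset ι) (f : ι → G) :
    translationVariation b (∑ i ∈ s, f i) ≤ ∑ i ∈ s, translationVariation b (f i) :=
  Finset.le_sum_of_subadditive _ (translationVariation_zero b).le
    (translationVariation_add_le b) s f

end TranslationVariation

lemma translationVariation_le_sup_natAbs {ι V : Type*} [Fintype ι] [DecidableEq ι]
    [NormedAddCommGroup V] (b : (ι → ℤ) → V) (q : ι → ℤ) :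
    translationVariation b q ≤ (∑ k, translationVariation b (Pi.single k 1)) *
      ((Finset.univ.sup fun j => (q j).natAbs : ℕ) : ℝ≥0∞) := by
  have hq : q = ∑ k, q k • (Pi.single k 1 : ι → ℤ) := by
    simpa [← Pi.single_smul] using (Finset.univ_sum_single q).symm
  calc translationVariation b q
      = translationVariation b (∑ k, q k • (Pi.single k 1 : ι → ℤ)) := by rw [← hq]
    _ ≤ ∑ k, translationVariation b (q k • (Pi.single k 1 : ι → ℤ)) :=
        translationVariation_sum_le b _ _
    _ ≤ ∑ k, translationVariation b (Pi.single k 1) *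
          ((Finset.univ.sup fun j => (q j).natAbs : ℕ) : ℝ≥0∞) := by
        refine Finset.sum_le_sum fun k hk => (translationVariation_zsmul_le b _ _).trans ?_
        rw [mul_comm]
        gcongr
        exact Finset.le_sup (f := fun j => (q j).natAbs) hk
    _ = _ := (Finset.sum_mul ..).symm

lemma tsum_mul_translate_sub_eq {G : Type*} [AddCommGroup G] {a b : G → ℂ}
    (ha : Summable fun q => ‖a q‖) (hb : Summable fun q => ‖b q‖)
    (ha1 : ∑' q, a q = 1) (x : G) :
    (∑' q, a q * b (x - q)) - b x = ∑' q, a q * (b (x - q) - b x) := by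
  have hab : Summable fun q => a q * b (x - q) := by
    refine Summable.of_norm_bounded (ha.mul_right (∑' y, ‖b y‖)) fun q => ?_
    rw [norm_mul]
    gcongr
    exact hb.le_tsum (x - q) fun _ _ => norm_nonneg _
  simp_rw [mul_sub]
  rw [hab.tsum_sub (ha.of_norm.mul_right (b x)), tsum_mul_right, ha1, one_mul]

/-- If `a, b ∈ ℓ¹(ℤ^d)` and `Σ_q a[q] = 1`, then
`‖a*b − b‖₁ ≤ (Σ_k ‖∇_k b‖₁) · Σ_q |q|_∞ |a[q]|`, the right-hand side being
interpreted in `ℝ≥0∞` (so the statement is trivially true if it diverges). -/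
theorem conv_reg_l1
    (d : ℕ) (hd : 1 ≤ d) (a b : (Fin d → ℤ) → ℂ)
    (ha : Summable fun q => ‖a q‖) (hb : Summable fun q => ‖b q‖)
    (ha1 : ∑' q, a q = 1) :
    ∑' q' : Fin d → ℤ, (‖(∑' q : Fin d → ℤ, a q * b (q' - q)) - b q'‖₊ : ℝ≥0∞)
      ≤ (∑ k : Fin d, ∑' q : Fin d → ℤ, (‖b (q + Pi.single k 1) - b q‖₊ : ℝ≥0∞))
        * ∑' q : Fin d → ℤ,
            ((Finset.univ.sup fun j => (q j).natAbs : ℕ) : ℝ≥0∞) * (‖a q‖₊ : ℝ≥0∞) := by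
  simp_rw [tsum_mul_translate_sub_eq ha hb ha1]
  calc ∑' x : Fin d → ℤ, ‖∑' q, a q * (b (x - q) - b x)‖ₑ
      ≤ ∑' x : Fin d → ℤ, ∑' q, ‖a q * (b (x - q) - b x)‖ₑ :=
        ENNReal.tsum_le_tsum fun x => enorm_tsum_le_tsum_enorm
    _ = ∑' q, ‖a q‖ₑ * translationVariation b q := by
        rw [ENNReal.tsum_comm]
        refine tsum_congr fun q => ?_
        simp_rw [enorm_mul]
        rw [ENNReal.tsum_mul_left, ← translationVariation_neg]
        simp only [translationVariation, sub_eq_add_neg]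
    _ ≤ ∑' q, ‖a q‖ₑ * ((∑ k, translationVariation b (Pi.single k 1)) *
          ((Finset.univ.sup fun j => (q j).natAbs : ℕ) : ℝ≥0∞)) := by
        gcongr with q
        exact translationVariation_le_sup_natAbs b q
    _ = (∑ k, translationVariation b (Pi.single k 1)) * ∑' q : Fin d → ℤ,
          ((Finset.univ.sup fun j => (q j).natAbs : ℕ) : ℝ≥0∞) * ‖a q‖ₑ := by
        rw [← ENNReal.tsum_mul_left]
        exact tsum_congr fun q => by ring
end

section
/- There is a constant C depending only on d such that for every W ∈ (0,1] and every real L ≥ 2, Σ_{q∈ℤ^d, |q| > L} ( ∏_{j=1}^d sin(π W q_j)/(π q_j) )² ≤ C W^{d−1} / L, where |q| denotes the Euclidean norm of q and the factor sin(π W q_j)/(π q_j) is interpreted as W when q_j = 0. -/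
open Finset

/-- `h[q] = ∏_j sin(π W q_j)/(π q_j)`, with the factor interpreted as `W` when `q_j = 0`. -/
noncomputable def hFC (d : ℕ) (W : ℝ) (q : Fin d → ℤ) : ℝ :=
  ∏ j, if q j = 0 then W else Real.sin (Real.pi * W * (q j : ℝ)) / (Real.pi * (q j : ℝ))

/-- The square of one factor of `hFC`. -/
noncomputable def hFCFactorSq (W : ℝ) (n : ℤ) : ℝ :=
  (if n = 0 then W else Real.sin (Real.pi * W * (n : ℝ)) / (Real.pi * (n : ℝ))) ^ 2

lemma hFCFactorSq_nonneg (W : ℝ) (n : ℤ) : 0 ≤ hFCFactorSq W n := sq_nonneg _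

lemma hFCFactorSq_le_sq (W : ℝ) (n : ℤ) : hFCFactorSq W n ≤ W ^ 2 := by
  unfold hFCFactorSq
  split_ifs with h
  · exact le_rfl
  · have hn : (n : ℝ) ≠ 0 := by exact_mod_cast h
    have hpos : 0 < |Real.pi * (n : ℝ)| := abs_pos.mpr (mul_ne_zero Real.pi_ne_zero hn)
    rw [sq_le_sq, abs_div, div_le_iff₀ hpos, ← abs_mul]
    refine Real.abs_sin_le_abs.trans_eq ?_
    congr 1
    ring

lemma hFCFactorSq_le_inv_sq (W : ℝ) {n : ℤ} (h : n ≠ 0) :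
    hFCFactorSq W n ≤ ((n : ℝ) ^ 2)⁻¹ := by
  have hn : (n : ℝ) ≠ 0 := by exact_mod_cast h
  have hn2 : 0 < (n : ℝ) ^ 2 := by positivity
  have hpi : 1 ≤ Real.pi ^ 2 := by nlinarith [Real.pi_gt_three]
  rw [hFCFactorSq, if_neg h, div_pow, mul_pow, ← one_div]
  refine div_le_div₀ zero_le_one (Real.sin_sq_le_one _) hn2 ?_
  nlinarith

lemma sum_inv_sq_tail_le (s : Finset ℤ) {M : ℝ} (hM : 0 < M) :
    ∑ n ∈ s with M < |((n : ℤ) : ℝ)|, ((n : ℝ) ^ 2)⁻¹ ≤ 4 / M := by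
  set N : ℕ := s.sup Int.natAbs
  set I : Finset ℕ := Ioo ⌊M⌋₊ (N + 1) with hI
  have hsub : s.filter (fun n : ℤ => M < |(n : ℝ)|) ⊆
      I.image (fun k : ℕ => (k : ℤ)) ∪ I.image (fun k : ℕ => -(k : ℤ)) := by
    intro n hn
    rw [mem_filter] at hn
    have hmem : n.natAbs ∈ I := by
      rw [hI, mem_Ioo, Nat.lt_succ_iff]
      refine ⟨(Nat.floor_lt hM.le).mpr ?_, le_sup (f := Int.natAbs) hn.1⟩
      simpa [Nat.cast_natAbs] using hn.2
    simp only [mem_union, mem_image]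
    rcases Int.natAbs_eq n with h | h
    · exact Or.inl ⟨_, hmem, h.symm⟩
    · exact Or.inr ⟨_, hmem, h.symm⟩
  have hI_le : ∑ k ∈ I, ((k : ℝ) ^ 2)⁻¹ ≤ 2 / M := by
    refine (sum_Ioo_inv_sq_le _ _).trans ?_
    exact div_le_div_of_nonneg_left (by norm_num) hM (Nat.lt_floor_add_one M).le
  calc ∑ n ∈ s with M < |((n : ℤ) : ℝ)|, ((n : ℝ) ^ 2)⁻¹
      ≤ ∑ n ∈ I.image (fun k : ℕ => (k : ℤ)) ∪ I.image (fun k : ℕ => -(k : ℤ)),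
          ((n : ℝ) ^ 2)⁻¹ :=
        sum_le_sum_of_subset_of_nonneg hsub fun _ _ _ => by positivity
    _ ≤ ∑ n ∈ I.image (fun k : ℕ => (k : ℤ)), ((n : ℝ) ^ 2)⁻¹ +
          ∑ n ∈ I.image (fun k : ℕ => -(k : ℤ)), ((n : ℝ) ^ 2)⁻¹ := by
        rw [← sum_union_inter]
        exact le_add_of_nonneg_right (sum_nonneg fun _ _ => by positivity)
    _ = ∑ k ∈ I, ((k : ℝ) ^ 2)⁻¹ + ∑ k ∈ I, ((k : ℝ) ^ 2)⁻¹ := by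
        rw [sum_image (by intro a _ b _ h; simpa using h),
          sum_image (by intro a _ b _ h; simpa using h)]
        simp
    _ ≤ 4 / M := by
        have : 4 / M = 2 / M + 2 / M := by ring
        linarith

lemma sum_hFCFactorSq_tail_le (W : ℝ) (s : Finset ℤ) {M : ℝ} (hM : 0 < M) :
    ∑ n ∈ s with M < |((n : ℤ) : ℝ)|, hFCFactorSq W n ≤ 4 / M := by
  refine le_trans (sum_le_sum fun n hn => ?_) (sum_inv_sq_tail_le s hM)
  refine hFCFactorSq_le_inv_sq W ?_
  rintro rfl
  have := (mem_filter.mp hn).2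
  simp only [Int.cast_zero, abs_zero] at this
  linarith

lemma sum_hFCFactorSq_le {W : ℝ} (hW : 0 < W) (hW1 : W ≤ 1) (s : Finset ℤ) :
    ∑ n ∈ s, hFCFactorSq W n ≤ 7 * W := by
  have hinv : 1 ≤ W⁻¹ := (one_le_inv₀ hW).mpr hW1
  have htail := sum_hFCFactorSq_tail_le W s (inv_pos.mpr hW)
  have hsub : s.filter (fun n : ℤ => ¬ W⁻¹ < |(n : ℝ)|) ⊆
      Icc (-(⌊W⁻¹⌋₊ : ℤ)) ⌊W⁻¹⌋₊ := by
    intro n hn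
    have h := not_lt.mp (mem_filter.mp hn).2
    have h' : n.natAbs ≤ ⌊W⁻¹⌋₊ := by
      refine Nat.le_floor ?_
      simpa [Nat.cast_natAbs] using h
    rw [mem_Icc]
    omega
  have hcard : ((s.filter (fun n : ℤ => ¬ W⁻¹ < |(n : ℝ)|)).card : ℝ) ≤ 3 * W⁻¹ := by
    have h1 := card_le_card hsub
    rw [Int.card_Icc] at h1
    have h2 : (s.filter (fun n : ℤ => ¬ W⁻¹ < |(n : ℝ)|)).card ≤ 2 * ⌊W⁻¹⌋₊ + 1 := by omega
    have h3 : ((s.filter (fun n : ℤ => ¬ W⁻¹ < |(n : ℝ)|)).card : ℝ) ≤ 2 * ⌊W⁻¹⌋₊ + 1 := by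
      exact_mod_cast h2
    have h4 := Nat.floor_le (inv_pos.mpr hW).le
    linarith
  have hhead : ∑ n ∈ s with ¬ W⁻¹ < |((n : ℤ) : ℝ)|, hFCFactorSq W n ≤ 3 * W := by
    refine (sum_le_card_nsmul _ _ _ fun n _ => hFCFactorSq_le_sq W n).trans ?_
    rw [nsmul_eq_mul]
    calc _ ≤ 3 * W⁻¹ * W ^ 2 := mul_le_mul_of_nonneg_right hcard (sq_nonneg W)
      _ = 3 * W := by field_simp
  rw [← sum_filter_add_sum_filter_not s (fun n : ℤ => W⁻¹ < |(n : ℝ)|)]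
  rw [div_inv_eq_mul] at htail
  linarith

lemma exists_div_lt_abs_of_lt_sqrt {d : ℕ} (hd : 1 ≤ d) {L : ℝ} (hL : 0 ≤ L) (x : Fin d → ℝ)
    (h : L < Real.sqrt (∑ j, x j ^ 2)) : ∃ j, L / d < |x j| := by
  by_contra! hx
  have hd' : (1 : ℝ) ≤ d := by exact_mod_cast hd
  refine absurd h (not_lt.mpr ?_)
  rw [Real.sqrt_le_left hL]
  calc ∑ j, x j ^ 2 ≤ ∑ _j : Fin d, (L / d) ^ 2 :=
        sum_le_sum fun j _ => sq_le_sq' (neg_le_of_abs_le (hx j)) (le_of_abs_le (hx j))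
    _ = L ^ 2 / d := by
        rw [sum_const, card_univ, Fintype.card_fin, nsmul_eq_mul]
        field_simp
    _ ≤ L ^ 2 := div_le_self (sq_nonneg L) hd'

/-- Tail bound: `Σ_{|q| > L} h[q]² ≤ C W^{d−1} / L` with `C` depending only on `d`. -/
theorem tail_sum_bound (d : ℕ) (hd : 1 ≤ d) :
    ∃ C : ℝ, 0 < C ∧ ∀ W L : ℝ, 0 < W → W ≤ 1 → 2 ≤ L →
      ∑' q : Fin d → ℤ,
          (if L < Real.sqrt (∑ j, ((q j : ℝ)) ^ 2) then hFC d W q ^ 2 else 0)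
        ≤ C * W ^ (d - 1) / L := by
  have hd0 : (0 : ℝ) < d := by exact_mod_cast hd
  refine ⟨4 * d ^ 2 * 7 ^ (d - 1), by positivity, fun W L hW hW1 hL => ?_⟩
  have hL0 : 0 < L := by linarith
  refine Real.tsum_le_of_sum_le (fun q => by split_ifs <;> positivity) fun u => ?_
  -- the factor in direction `j` is truncated to the tail `|n| > L / d`
  let t : Fin d → Fin d → ℤ → ℝ := fun j i n =>
    if i = j then (if L / d < |(n : ℝ)| then hFCFactorSq W n else 0) else hFCFactorSq W n
  have ht0 : ∀ j i n, 0 ≤ t j i n := fun j i n => by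
    have := hFCFactorSq_nonneg W n
    simp only [t]
    split_ifs <;> first | exact this | exact le_rfl
  let s : Finset ℤ := u.biUnion fun q => univ.image q
  have hus : u ⊆ Fintype.piFinset fun _ : Fin d => s := fun q hq => by
    rw [Fintype.mem_piFinset]
    exact fun j => mem_biUnion.mpr ⟨q, hq, mem_image_of_mem q (mem_univ j)⟩
  have hpoint : ∀ q : Fin d → ℤ,
      (if L < Real.sqrt (∑ j, ((q j : ℝ)) ^ 2) then hFC d W q ^ 2 else 0)
        ≤ ∑ j, ∏ i, t j i (q i) := fun q => by
    have hnn : ∀ j ∈ univ, 0 ≤ ∏ i, t j i (q i) := fun j _ => prod_nonneg fun i _ => ht0 j i _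
    split_ifs with h
    · obtain ⟨j, hj⟩ := exists_div_lt_abs_of_lt_sqrt hd hL0.le (fun j => (q j : ℝ)) h
      refine le_trans (le_of_eq ?_) (single_le_sum hnn (mem_univ j))
      rw [hFC, ← prod_pow]
      refine prod_congr rfl fun i _ => ?_
      by_cases hij : i = j
      · subst hij
        simp only [t, if_pos hj, if_true]
        rfl
      · simp only [t, if_neg hij]
        rfl
    · exact sum_nonneg hnn
  have hprod : ∀ j, ∏ i, ∑ n ∈ s, t j i n ≤ 4 / (L / d) * (7 * W) ^ (d - 1) := fun j => by
    rw [← mul_prod_erase univ _ (mem_univ j)]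
    refine mul_le_mul ?_ ?_ (prod_nonneg fun i _ => sum_nonneg fun n _ => ht0 j i n)
      (by positivity)
    · simp only [t, if_true]
      rw [← sum_filter]
      exact sum_hFCFactorSq_tail_le W s (by positivity)
    · refine (prod_le_prod (fun i _ => sum_nonneg fun n _ => ht0 j i n)
        (g := fun _ => 7 * W) fun i hi => ?_).trans_eq ?_
      · simp only [t, if_neg (ne_of_mem_erase hi)]
        exact sum_hFCFactorSq_le hW hW1 s
      · rw [prod_const, card_erase_of_mem (mem_univ j), card_univ, Fintype.card_fin]
  calc _ ≤ ∑ q ∈ u, ∑ j, ∏ i, t j i (q i) := sum_le_sum fun q _ => hpoint q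
    _ ≤ ∑ q ∈ Fintype.piFinset fun _ : Fin d => s, ∑ j, ∏ i, t j i (q i) :=
        sum_le_sum_of_subset_of_nonneg hus fun q _ _ =>
          sum_nonneg fun j _ => prod_nonneg fun i _ => ht0 j i _
    _ = ∑ j, ∏ i, ∑ n ∈ s, t j i n := by
        rw [sum_comm]
        exact sum_congr rfl fun j _ => (prod_univ_sum _ _).symm
    _ ≤ ∑ _j : Fin d, 4 / (L / d) * (7 * W) ^ (d - 1) := sum_le_sum fun j _ => hprod j
    _ = 4 * d ^ 2 * 7 ^ (d - 1) * W ^ (d - 1) / L := by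
        rw [sum_const, card_univ, Fintype.card_fin, nsmul_eq_mul, mul_pow]
        field_simp
end

section
/- There is a constant C depending only on d such that for every W ∈ (0,1] and every real L ≥ 2, Σ_{q∈ℤ^d, |q| ≤ L} |q| ( ∏_{j=1}^d sin(π W q_j)/(π q_j) )² ≤ C W^{d−1} log L, where |q| denotes the Euclidean norm of q and the factor sin(π W q_j)/(π q_j) is interpreted as W when q_j = 0. -/
open Finset

/-- The `n`-th Fourier coefficient of the indicator of `[-W/2, W/2]`. -/
noncomputable def intervalCoeff (W : ℝ) (n : ℤ) : ℝ :=
  if n = 0 then W else Real.sin (Real.pi * W * (n : ℝ)) / (Real.pi * (n : ℝ))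

theorem intervalCoeff_neg (W : ℝ) (n : ℤ) : intervalCoeff W (-n) = intervalCoeff W n := by
  simp [intervalCoeff]

theorem intervalCoeff_sq_le_sq (W : ℝ) (n : ℤ) : intervalCoeff W n ^ 2 ≤ W ^ 2 := by
  unfold intervalCoeff
  split_ifs with h
  · exact le_rfl
  · have hn : (n : ℝ) ≠ 0 := by exact_mod_cast h
    have hpos : 0 < (Real.pi * (n : ℝ)) ^ 2 := by positivity
    rw [div_pow, div_le_iff₀ hpos]
    calc _ ≤ (Real.pi * W * (n : ℝ)) ^ 2 := Real.sin_sq_le_sq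
      _ = _ := by ring

theorem intervalCoeff_sq_le_inv_sq (W : ℝ) {n : ℤ} (h : n ≠ 0) :
    intervalCoeff W n ^ 2 ≤ ((n : ℝ) ^ 2)⁻¹ := by
  have hn : (n : ℝ) ≠ 0 := by exact_mod_cast h
  rw [intervalCoeff, if_neg h, div_pow, mul_pow, inv_eq_one_div]
  gcongr
  · exact Real.sin_sq_le_one _
  · have : 1 ≤ Real.pi ^ 2 := by nlinarith [Real.pi_gt_three]
    nlinarith [sq_nonneg (n : ℝ)]

theorem sum_Icc_neg_le_of_even {f : ℤ → ℝ} (hf : ∀ n, f (-n) = f n) (h0 : 0 ≤ f 0) (N : ℕ) :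
    ∑ n ∈ Icc (-(N : ℤ)) N, f n ≤ 2 * ∑ k ∈ range (N + 1), f k := by
  rw [sum_Icc_of_even_eq_range hf, nsmul_eq_mul]
  push_cast
  linarith

theorem sum_intervalCoeff_sq_le {W : ℝ} (hW : 0 < W) (hW1 : W ≤ 1) (N : ℕ) :
    ∑ n ∈ Icc (-(N : ℤ)) N, intervalCoeff W n ^ 2 ≤ 8 * W := by
  refine (sum_Icc_neg_le_of_even (fun n => by rw [intervalCoeff_neg]) (sq_nonneg _) N).trans ?_
  set M := ⌊W⁻¹⌋₊
  have hM : (M : ℝ) * W ≤ 1 := by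
    rw [← le_div_iff₀ hW, one_div]
    exact Nat.floor_le (by positivity)
  have hM' : 1 ≤ W * (M + 1) := by
    rw [← div_le_iff₀' hW, one_div]
    exact (Nat.lt_floor_add_one _).le
  have hsub : range (N + 1) ⊆ range (M + 1) ∪ Ioo M (N + 1) := by
    intro k hk
    simp only [mem_union, mem_range, mem_Ioo] at hk ⊢
    omega
  have hdisj : Disjoint (range (M + 1)) (Ioo M (N + 1)) := by
    rw [Finset.disjoint_left]
    intro k hk
    simp only [mem_range, mem_Ioo] at hk ⊢
    omega
  have hlow : ∑ k ∈ range (M + 1), intervalCoeff W k ^ 2 ≤ 2 * W := by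
    calc _ ≤ ∑ _k ∈ range (M + 1), W ^ 2 :=
          sum_le_sum fun k _ => intervalCoeff_sq_le_sq W k
      _ = (M * W + W) * W := by
          rw [sum_const, card_range, nsmul_eq_mul]
          push_cast
          ring
      _ ≤ 2 * W := by gcongr; linarith
  have hhigh : ∑ k ∈ Ioo M (N + 1), intervalCoeff W k ^ 2 ≤ 2 * W := by
    calc _ ≤ ∑ k ∈ Ioo M (N + 1), ((k : ℝ) ^ 2)⁻¹ := by
          refine sum_le_sum fun k hk => ?_
          have hk0 : (k : ℤ) ≠ 0 := by
            rw [mem_Ioo] at hk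
            omega
          simpa using intervalCoeff_sq_le_inv_sq W hk0
      _ ≤ 2 / (M + 1) := sum_Ioo_inv_sq_le M (N + 1)
      _ ≤ 2 * W := by
          rw [div_le_iff₀ (by positivity)]
          linarith
  have hsum : ∑ k ∈ range (N + 1), intervalCoeff W k ^ 2 ≤
      ∑ k ∈ range (M + 1) ∪ Ioo M (N + 1), intervalCoeff W k ^ 2 :=
    sum_le_sum_of_subset_of_nonneg hsub fun _ _ _ => sq_nonneg _
  rw [sum_union hdisj] at hsum
  linarith

theorem sum_abs_mul_intervalCoeff_sq_le (W : ℝ) {L : ℝ} (hL : 2 ≤ L) :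
    ∑ n ∈ Icc (-(⌊L⌋₊ : ℤ)) ⌊L⌋₊, |(n : ℝ)| * intervalCoeff W n ^ 2 ≤ 6 * Real.log L := by
  have heven (n : ℤ) : |((-n : ℤ) : ℝ)| * intervalCoeff W (-n) ^ 2 =
      |(n : ℝ)| * intervalCoeff W n ^ 2 := by
    rw [intervalCoeff_neg, Int.cast_neg, abs_neg]
  refine (sum_Icc_neg_le_of_even heven (by positivity) _).trans ?_
  have hharm : ∑ k ∈ range (⌊L⌋₊ + 1), |((k : ℤ) : ℝ)| * intervalCoeff W k ^ 2 ≤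
      (harmonic ⌊L⌋₊ : ℝ) := by
    rw [sum_range_succ', harmonic]
    push_cast
    simp only [abs_zero, zero_mul, add_zero]
    refine sum_le_sum fun k _ => ?_
    have hk := intervalCoeff_sq_le_inv_sq W (n := (k : ℤ) + 1) (by omega)
    push_cast at hk
    have hpos : (0 : ℝ) < (k : ℝ) + 1 := by positivity
    rw [abs_of_pos hpos]
    calc _ ≤ ((k : ℝ) + 1) * (((k : ℝ) + 1) ^ 2)⁻¹ := by gcongr
      _ = _ := by field_simp
  have hfloor : Real.log ⌊L⌋₊ ≤ Real.log L := by
    apply Real.log_le_log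
    · exact_mod_cast Nat.floor_pos.2 (by linarith)
    · exact Nat.floor_le (by linarith)
  have hlog : Real.log 2 ≤ Real.log L := Real.log_le_log (by norm_num) hL
  linarith [harmonic_le_one_add_log ⌊L⌋₊, Real.log_two_gt_d9]

theorem hFC_sq (d : ℕ) (W : ℝ) (q : Fin d → ℤ) :
    hFC d W q ^ 2 = ∏ j, intervalCoeff W (q j) ^ 2 := by
  rw [prod_pow]
  rfl

theorem sum_abs_coord_mul_hFC_sq {d : ℕ} (W : ℝ) (s : Finset ℤ) (i : Fin d) :
    ∑ q ∈ Fintype.piFinset fun _ : Fin d => s, |(q i : ℝ)| * hFC d W q ^ 2 =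
      (∑ n ∈ s, |(n : ℝ)| * intervalCoeff W n ^ 2) *
        (∑ n ∈ s, intervalCoeff W n ^ 2) ^ (d - 1) := by
  have hterm (q : Fin d → ℤ) : |(q i : ℝ)| * hFC d W q ^ 2 =
      ∏ j, (if j = i then |(q j : ℝ)| else 1) * intervalCoeff W (q j) ^ 2 := by
    rw [hFC_sq, prod_mul_distrib, prod_ite_eq' univ i, if_pos (mem_univ i)]
  simp_rw [hterm]
  rw [← prod_univ_sum (fun _ => s) fun j n =>
    (if j = i then |(n : ℝ)| else 1) * intervalCoeff W n ^ 2,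
    ← mul_prod_erase univ _ (mem_univ i)]
  congr 1
  · simp
  · rw [prod_eq_pow_card (b := ∑ n ∈ s, intervalCoeff W n ^ 2) fun j hj => by
      simp only [if_neg (ne_of_mem_erase hj), one_mul]]
    simp

theorem sqrt_sum_sq_le_sum_abs {ι : Type*} (s : Finset ι) (x : ι → ℝ) :
    Real.sqrt (∑ j ∈ s, x j ^ 2) ≤ ∑ j ∈ s, |x j| := by
  rw [Real.sqrt_le_left (sum_nonneg fun _ _ => abs_nonneg _)]
  simpa only [sq_abs] using sum_sq_le_sq_sum_of_nonneg fun j (_ : j ∈ s) => abs_nonneg (x j)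

theorem mem_piFinset_Icc_floor_of_sqrt_sum_sq_le {d : ℕ} {q : Fin d → ℤ} {L : ℝ}
    (h : Real.sqrt (∑ j, (q j : ℝ) ^ 2) ≤ L) :
    q ∈ Fintype.piFinset fun _ : Fin d => Icc (-(⌊L⌋₊ : ℤ)) ⌊L⌋₊ := by
  refine Fintype.mem_piFinset.2 fun j => ?_
  have habs : |(q j : ℝ)| ≤ L :=
    (Real.abs_le_sqrt (single_le_sum (fun k _ => sq_nonneg (q k : ℝ)) (mem_univ j))).trans h
  have hnat : (q j).natAbs ≤ ⌊L⌋₊ := Nat.le_floor (by rwa [Nat.cast_natAbs, Int.cast_abs])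
  rw [mem_Icc]
  omega

/-- `Σ_{|q| ≤ L} |q| h[q]² ≤ C W^{d−1} log L` with `C` depending only on `d`. -/
theorem weighted_sum_bound (d : ℕ) (hd : 1 ≤ d) :
    ∃ C : ℝ, 0 < C ∧ ∀ W L : ℝ, 0 < W → W ≤ 1 → 2 ≤ L →
      ∑' q : Fin d → ℤ,
          (if Real.sqrt (∑ j, ((q j : ℝ)) ^ 2) ≤ L then
            Real.sqrt (∑ j, ((q j : ℝ)) ^ 2) * hFC d W q ^ 2 else 0)
        ≤ C * W ^ (d - 1) * Real.log L := by
  refine ⟨d * 6 * 8 ^ (d - 1), by positivity, fun W L hW hW1 hL => ?_⟩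
  set s := Icc (-(⌊L⌋₊ : ℤ)) ⌊L⌋₊
  have hlog : 0 ≤ Real.log L := Real.log_nonneg (by linarith)
  rw [tsum_eq_sum (s := Fintype.piFinset fun _ : Fin d => s) fun q hq =>
    if_neg fun h => hq (mem_piFinset_Icc_floor_of_sqrt_sum_sq_le h)]
  calc _ ≤ ∑ q ∈ Fintype.piFinset fun _ : Fin d => s, ∑ i, |(q i : ℝ)| * hFC d W q ^ 2 := by
        refine sum_le_sum fun q _ => ?_
        rw [← sum_mul]
        split_ifs
        · gcongr
          exact sqrt_sum_sq_le_sum_abs _ _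
        · positivity
    _ = ∑ _i : Fin d, (∑ n ∈ s, |(n : ℝ)| * intervalCoeff W n ^ 2) *
          (∑ n ∈ s, intervalCoeff W n ^ 2) ^ (d - 1) := by
        rw [sum_comm]
        exact sum_congr rfl fun i _ => sum_abs_coord_mul_hFC_sq W s i
    _ ≤ ∑ _i : Fin d, (6 * Real.log L) * (8 * W) ^ (d - 1) := by
        gcongr
        · exact sum_abs_mul_intervalCoeff_sq_le W hL
        · exact sum_intervalCoeff_sq_le hW hW1 _
    _ = _ := by
        rw [sum_const, card_univ, Fintype.card_fin, nsmul_eq_mul, mul_pow]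
        ring
end

section
/- Let d ≥ 1, let Ω ⊆ ℤ^d be finite and nonempty with cardinality n_Ω, let W ∈ (0,1), and let K be an integer with n_Ω W^d ≤ K ≤ n_Ω. Let m_1, …, m_K be orthonormal eigenvectors of T^{Ω,W} (as an operator on functions supported on Ω) associated with its K largest eigenvalues λ_1 ≥ … ≥ λ_K (counted with multiplicity), and set ρ(ξ) = (1/K) Σ_{k=1}^K |Σ_{q∈Ω} m_k[q] e^{2πi q·ξ}|². Then ∫_{[-1/2,1/2]^d} | ρ(ξ) − (n_Ω/K) 1_{[-W/2,W/2]^d}(ξ) | dξ ≤ 2 ( 1 − (1/K) Σ_{k=1}^K λ_k ). -/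
open Finset MeasureTheory

/-- `e^{2πi q·ξ}` for `q ∈ ℤ^d`, `ξ ∈ ℝ^d`. -/
noncomputable def eK (d : ℕ) (q : Fin d → ℤ) (ξ : Fin d → ℝ) : ℂ :=
  Complex.exp (2 * Real.pi * Complex.I * ∑ j, (q j : ℂ) * (ξ j : ℂ))

/-- The `d`-dimensional normalized sinc function. -/
noncomputable def sincd (d : ℕ) (u : Fin d → ℝ) : ℝ :=
  ∏ j, if u j = 0 then 1 else Real.sin (Real.pi * u j) / (Real.pi * u j)

/-- The concentration matrix `T^{Ω,W}`. -/
noncomputable def Tmat (d : ℕ) (Ω : Finset (Fin d → ℤ)) (W : ℝ) (q q' : Fin d → ℤ) : ℝ :=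
  W ^ d * (if q ∈ Ω then (1 : ℝ) else 0)
    * sincd d (fun j => W * ((q j : ℝ) - (q' j : ℝ)))
    * (if q' ∈ Ω then (1 : ℝ) else 0)

/-- The centred cube of side `W` in `ℝ^d`. -/
abbrev centredCube (d : ℕ) (W : ℝ) : Set (Fin d → ℝ) :=
  Set.Icc (fun _ : Fin d => -(W / 2)) (fun _ => W / 2)

theorem integral_exp_centred (a W : ℝ) (hW : 0 < W) :
    ∫ x in Set.Icc (-(W / 2)) (W / 2), Complex.exp (2 * Real.pi * Complex.I * (a * x))
      = (W * (if W * a = 0 then 1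
          else Real.sin (Real.pi * (W * a)) / (Real.pi * (W * a))) : ℝ) := by
  rw [integral_Icc_eq_integral_Ioc, ← intervalIntegral.integral_of_le (by linarith)]
  by_cases ha : a = 0
  · simp [ha]
  · have hc : (2 * Real.pi * Complex.I * a : ℂ) ≠ 0 := by
      simp [ha, Real.pi_ne_zero]
    have h := integral_exp_mul_complex (a := -(W / 2)) (b := W / 2) hc
    simp only [mul_assoc] at h ⊢
    rw [h, if_neg (by simp [ha, hW.ne'])]
    have hpi : (Real.pi : ℂ) ≠ 0 := by exact_mod_cast Real.pi_ne_zero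
    have ha' : (a : ℂ) ≠ 0 := by exact_mod_cast ha
    have hW' : (W : ℂ) ≠ 0 := by exact_mod_cast hW.ne'
    push_cast
    rw [Complex.sin]
    have e1 : (2 * (Real.pi * (Complex.I * (a * (W / 2)))) : ℂ)
        = Real.pi * (W * a) * Complex.I := by ring
    have e2 : (2 * (Real.pi * (Complex.I * (a * -(W / 2)))) : ℂ)
        = -(Real.pi * (W * a)) * Complex.I := by ring
    rw [e1, e2]
    field_simp
    rw [Complex.I_sq]
    ring

theorem eK_mul_conj (d : ℕ) (q q' : Fin d → ℤ) (ξ : Fin d → ℝ) :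
    eK d q ξ * (starRingEnd ℂ) (eK d q' ξ)
      = ∏ j, Complex.exp
          (2 * Real.pi * Complex.I * (((q j : ℝ) - (q' j : ℝ) : ℝ) * (ξ j : ℂ))) := by
  rw [eK, eK, ← Complex.exp_conj, ← Complex.exp_add, ← Complex.exp_sum, ← Finset.mul_sum]
  congr 1
  simp only [map_mul, map_sum, Complex.conj_ofReal, Complex.conj_I, map_ofNat, map_intCast]
  push_cast
  simp only [sub_mul, Finset.sum_sub_distrib]
  ring

theorem norm_eK (d : ℕ) (q : Fin d → ℤ) (ξ : Fin d → ℝ) : ‖eK d q ξ‖ = 1 := by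
  have h := eK_mul_conj d q q ξ
  rw [Complex.mul_conj'] at h
  simp only [sub_self, Complex.ofReal_zero, zero_mul, mul_zero, Complex.exp_zero,
    Finset.prod_const_one] at h
  have h' : ‖eK d q ξ‖ ^ 2 = 1 := by exact_mod_cast h
  exact (pow_eq_one_iff_of_nonneg (norm_nonneg _) two_ne_zero).1 h'

@[fun_prop]
theorem continuous_eK (d : ℕ) (q : Fin d → ℤ) : Continuous (eK d q) := by
  unfold eK
  fun_prop

theorem integral_eK_mul_conj (d : ℕ) (W : ℝ) (hW : 0 < W) (q q' : Fin d → ℤ) :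
    ∫ ξ in centredCube d W, eK d q ξ * (starRingEnd ℂ) (eK d q' ξ)
      = (W ^ d * sincd d (fun j => W * ((q j : ℝ) - (q' j : ℝ))) : ℝ) := by
  simp only [eK_mul_conj]
  rw [centredCube, ← Set.pi_univ_Icc, volume_pi, Measure.restrict_pi_pi,
    integral_fintype_prod_eq_prod (𝕜 := ℂ) (f := fun j (x : ℝ) => Complex.exp
      (2 * Real.pi * Complex.I * (((q j : ℝ) - (q' j : ℝ) : ℝ) * (x : ℂ))))]
  simp only [integral_exp_centred _ W hW]
  rw [← Complex.ofReal_prod, Finset.prod_mul_distrib, sincd]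
  simp

/-- The energy of a trigonometric polynomial on a centred cube is a sinc-kernel quadratic form. -/
theorem integral_norm_sq_trig (d : ℕ) (W : ℝ) (hW : 0 < W) (Ω : Finset (Fin d → ℤ))
    (a : (Fin d → ℤ) → ℂ) :
    ((∫ ξ in centredCube d W, ‖∑ q ∈ Ω, a q * eK d q ξ‖ ^ 2 : ℝ) : ℂ)
      = ∑ q ∈ Ω, (∑ q' ∈ Ω, (W ^ d * sincd d (fun j => W * ((q j : ℝ) - (q' j : ℝ))) : ℝ)
          * a q') * (starRingEnd ℂ) (a q) := by
  have hint (q q' : Fin d → ℤ) : Integrable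
      (fun ξ => a q' * (starRingEnd ℂ) (a q) * (eK d q' ξ * (starRingEnd ℂ) (eK d q ξ)))
      (volume.restrict (centredCube d W)) :=
    Continuous.integrableOn_Icc (by fun_prop)
  have hsinc (q q' : Fin d → ℤ) : sincd d (fun j => W * ((q' j : ℝ) - (q j : ℝ)))
      = sincd d (fun j => W * ((q j : ℝ) - (q' j : ℝ))) := by
    refine Finset.prod_congr rfl fun j _ => ?_
    beta_reduce
    rw [← neg_sub (q j : ℝ), mul_neg, mul_neg, Real.sin_neg, neg_div_neg_eq]
    simp only [neg_eq_zero]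
  rw [← integral_complex_ofReal]
  have hexp (ξ : Fin d → ℝ) : ((‖∑ q ∈ Ω, a q * eK d q ξ‖ ^ 2 : ℝ) : ℂ)
      = ∑ q ∈ Ω, ∑ q' ∈ Ω,
        a q' * (starRingEnd ℂ) (a q) * (eK d q' ξ * (starRingEnd ℂ) (eK d q ξ)) := by
    push_cast
    rw [← Complex.mul_conj', map_sum, Finset.sum_mul_sum, Finset.sum_comm]
    refine Finset.sum_congr rfl fun q _ => Finset.sum_congr rfl fun q' _ => ?_
    rw [map_mul]
    ring
  simp only [hexp]
  rw [integral_finsetSum _ fun q _ => integrable_finsetSum _ fun q' _ => hint q q']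
  refine Finset.sum_congr rfl fun q _ => ?_
  rw [integral_finsetSum _ fun q' _ => hint q q', Finset.sum_mul]
  refine Finset.sum_congr rfl fun q' _ => ?_
  rw [integral_const_mul, integral_eK_mul_conj d W hW, hsinc]
  ring

theorem sincd_int_sub (d : ℕ) (q q' : Fin d → ℤ) :
    sincd d (fun j => (q j : ℝ) - (q' j : ℝ)) = if q = q' then 1 else 0 := by
  split_ifs with h
  · simp [sincd, h]
  · obtain ⟨j, hj⟩ := Function.ne_iff.1 h
    refine Finset.prod_eq_zero (Finset.mem_univ j) ?_
    have hs := Real.sin_int_mul_pi (q j - q' j)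
    push_cast at hs
    beta_reduce
    rw [if_neg (by simpa [sub_eq_zero] using hj), mul_comm Real.pi, hs, zero_div]

theorem integral_norm_sq_trig_unit (d : ℕ) (Ω : Finset (Fin d → ℤ)) (a : (Fin d → ℤ) → ℂ) :
    ((∫ ξ in centredCube d 1, ‖∑ q ∈ Ω, a q * eK d q ξ‖ ^ 2 : ℝ) : ℂ)
      = ∑ q ∈ Ω, a q * (starRingEnd ℂ) (a q) := by
  rw [integral_norm_sq_trig d 1 one_pos]
  refine Finset.sum_congr rfl fun q hq => ?_
  simp [sincd_int_sub, hq, apply_ite Complex.ofReal]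

theorem integral_norm_sq_trig_eigen (d : ℕ) (W : ℝ) (hW : 0 < W) (Ω : Finset (Fin d → ℤ))
    (a : (Fin d → ℤ) → ℂ) (l : ℝ)
    (heig : ∀ q, ∑ q' ∈ Ω, (Tmat d Ω W q q' : ℂ) * a q' = (l : ℂ) * a q) :
    ((∫ ξ in centredCube d W, ‖∑ q ∈ Ω, a q * eK d q ξ‖ ^ 2 : ℝ) : ℂ)
      = l * ∑ q ∈ Ω, a q * (starRingEnd ℂ) (a q) := by
  rw [integral_norm_sq_trig d W hW, Finset.mul_sum]
  refine Finset.sum_congr rfl fun q hq => ?_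
  rw [← mul_assoc, ← heig q]
  congr 1
  refine Finset.sum_congr rfl fun q' hq' => ?_
  simp [Tmat, hq, hq']

/-- Bessel's inequality applied to the vector of exponentials. -/
theorem sum_norm_sq_trig_le (d : ℕ) (Ω : Finset (Fin d → ℤ)) {ι : Type*} [DecidableEq ι]
    (m : ι → (Fin d → ℤ) → ℂ)
    (hon : ∀ k k', ∑ q ∈ Ω, m k q * (starRingEnd ℂ) (m k' q) = if k = k' then (1 : ℂ) else 0)
    (s : Finset ι) (ξ : Fin d → ℝ) :
    ∑ k ∈ s, ‖∑ q ∈ Ω, m k q * eK d q ξ‖ ^ 2 ≤ Ω.card := by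
  let v (k : ι) : EuclideanSpace ℂ Ω := WithLp.toLp 2 fun q => (starRingEnd ℂ) (m k q)
  let x : EuclideanSpace ℂ Ω := WithLp.toLp 2 fun q => eK d q ξ
  have hv : Orthonormal ℂ v := by
    rw [orthonormal_iff_ite]
    intro k k'
    rw [← hon k k', ← Finset.sum_coe_sort Ω]
    simp [v, PiLp.inner_apply, mul_comm]
  have hx : ‖x‖ ^ 2 = Ω.card := by
    rw [EuclideanSpace.norm_sq_eq]
    simp [x, norm_eK]
  have hin (k : ι) : inner ℂ (v k) x = ∑ q ∈ Ω, m k q * eK d q ξ := by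
    rw [← Finset.sum_coe_sort Ω]
    simp [v, x, PiLp.inner_apply, mul_comm]
  have h := hv.sum_inner_products_le (s := s) x
  simpa only [hin, hx] using h

/-- A density bounded by `c` on `Q` has `L¹` distance to `c 1_Q` computed by its mass on `Q`. -/
theorem integral_abs_sub_indicator {α : Type*} [MeasurableSpace α] (μ : Measure α)
    {Q I : Set α} (hQ : MeasurableSet Q) (hQI : Q ⊆ I)
    (hμ : μ Q ≠ ⊤) (f : α → ℝ) (c : ℝ) (hf : IntegrableOn f I μ)
    (hf0 : ∀ x, 0 ≤ f x) (hfc : ∀ x, f x ≤ c) :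
    ∫ x in I, |f x - c * Q.indicator (fun _ => (1 : ℝ)) x| ∂μ
      = (∫ x in I, f x ∂μ) + c * μ.real Q - 2 * ∫ x in Q, f x ∂μ := by
  have hpt (x : α) : |f x - c * Q.indicator (fun _ => (1 : ℝ)) x|
      = f x + Q.indicator (fun y => c - 2 * f y) x := by
    by_cases hx : x ∈ Q
    · simp only [Set.indicator_of_mem hx, mul_one]
      rw [abs_of_nonpos (by linarith [hfc x])]
      ring
    · simp [Set.indicator_of_notMem hx, abs_of_nonneg (hf0 x)]
  have hfQ : IntegrableOn f Q μ := hf.mono_set hQI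
  have hc : IntegrableOn (fun _ : α => c) Q μ := integrableOn_const hμ
  have hg : IntegrableOn (fun y => c - 2 * f y) Q μ := hc.sub (hfQ.const_mul 2)
  simp only [hpt]
  rw [integral_add hf ((hg.integrable_indicator hQ).integrableOn),
    setIntegral_indicator hQ, Set.inter_eq_right.2 hQI,
    integral_sub hc (hfQ.const_mul 2), integral_const_mul, setIntegral_const, smul_eq_mul]
  ring

theorem measureReal_centredCube (d : ℕ) (W : ℝ) (hW : 0 < W) :
    volume.real (centredCube d W) = W ^ d := by
  rw [Measure.real, Real.volume_Icc_pi_toReal (fun _ => by linarith)]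
  simp

/-- For the spectral window `ρ` built from orthonormal eigenvectors of `T^{Ω,W}`
associated with its `K` largest eigenvalues (here `m, lam` is a full orthonormal
eigenbasis with eigenvalues listed in decreasing order, and the first `K` members
are used), `∫ |ρ − (n_Ω/K) 1_{[-W/2,W/2]^d}| ≤ 2 (1 − (1/K) Σ_{k≤K} λ_k)`. -/
theorem specwin_eigen_sum
    (d : ℕ) (hd : 1 ≤ d) (Ω : Finset (Fin d → ℤ)) (hΩ : Ω.Nonempty)
    (W : ℝ) (hW0 : 0 < W) (hW1 : W < 1)
    (K : ℕ) (hK1 : (Ω.card : ℝ) * W ^ d ≤ K) (hK2 : K ≤ Ω.card)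
    (m : Fin Ω.card → (Fin d → ℤ) → ℂ) (lam : Fin Ω.card → ℝ)
    (hsupp : ∀ k q, q ∉ Ω → m k q = 0)
    (hon : ∀ k k', ∑ q ∈ Ω, m k q * (starRingEnd ℂ) (m k' q)
        = if k = k' then (1 : ℂ) else 0)
    (heig : ∀ k q, ∑ q' ∈ Ω, (Tmat d Ω W q q' : ℂ) * m k q' = (lam k : ℂ) * m k q)
    (hdec : Antitone lam) :
    (∫ ξ in Set.Icc (fun _ : Fin d => -(1 / 2 : ℝ)) (fun _ => 1 / 2),
        |(1 / K : ℝ) * ∑ k ∈ Finset.univ.filter (fun k : Fin Ω.card => (k : ℕ) < K),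
            ‖∑ q ∈ Ω, m k q * eK d q ξ‖ ^ 2
          - ((Ω.card : ℝ) / K)
              * (Set.Icc (fun _ : Fin d => -(W / 2)) (fun _ => W / 2)).indicator
                  (fun _ => (1 : ℝ)) ξ|)
      ≤ 2 * (1 - (1 / K : ℝ)
          * ∑ k ∈ Finset.univ.filter (fun k : Fin Ω.card => (k : ℕ) < K), lam k) := by
  have hKpos : (0 : ℝ) < K := by
    have : (0 : ℝ) < Ω.card := by exact_mod_cast hΩ.card_pos
    exact lt_of_lt_of_le (by positivity) hK1
  set s := Finset.univ.filter (fun k : Fin Ω.card => (k : ℕ) < K) with hs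
  have hscard : s.card = K := by
    rw [hs, Fin.card_filter_val_lt, min_eq_right hK2]
  have hnorm (k : Fin Ω.card) : ∑ q ∈ Ω, m k q * (starRingEnd ℂ) (m k q) = 1 := by
    simpa using hon k k
  have hunit (k : Fin Ω.card) :
      ∫ ξ in centredCube d 1, ‖∑ q ∈ Ω, m k q * eK d q ξ‖ ^ 2 = 1 := by
    have h := integral_norm_sq_trig_unit d Ω (m k)
    rw [hnorm] at h
    exact_mod_cast h
  have hlam (k : Fin Ω.card) :
      ∫ ξ in centredCube d W, ‖∑ q ∈ Ω, m k q * eK d q ξ‖ ^ 2 = lam k := by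
    have h := integral_norm_sq_trig_eigen d W hW0 Ω (m k) (lam k) (heig k)
    rw [hnorm, mul_one] at h
    exact_mod_cast h
  have hint (k : Fin Ω.card) (V : ℝ) :
      IntegrableOn (fun ξ => ‖∑ q ∈ Ω, m k q * eK d q ξ‖ ^ 2) (centredCube d V) :=
    Continuous.integrableOn_Icc (by fun_prop)
  have hsub : centredCube d W ⊆ centredCube d 1 :=
    Set.Icc_subset_Icc (fun _ => by simp only; linarith) (fun _ => by simp only; linarith)
  have key := integral_abs_sub_indicator volume (Q := centredCube d W) (I := centredCube d 1)
    measurableSet_Icc hsub isCompact_Icc.measure_ne_top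
    (fun ξ => (1 / K : ℝ) * ∑ k ∈ s, ‖∑ q ∈ Ω, m k q * eK d q ξ‖ ^ 2) ((Ω.card : ℝ) / K)
    ((integrable_finsetSum _ fun k _ => hint k 1).const_mul _)
    (fun ξ => by positivity)
    (fun ξ => by
      rw [one_div_mul_eq_div]
      gcongr
      exact sum_norm_sq_trig_le d Ω m hon s ξ)
  rw [integral_const_mul, integral_const_mul, integral_finsetSum _ fun k _ => hint k 1,
    integral_finsetSum _ fun k _ => hint k W, measureReal_centredCube d W hW0] at key
  simp only [hunit, hlam, Finset.sum_const, hscard, nsmul_eq_mul, mul_one] at key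
  refine key.trans_le ?_
  have h1 : (1 / K : ℝ) * K = 1 := one_div_mul_cancel hKpos.ne'
  have h2 : (Ω.card : ℝ) / K * W ^ d ≤ 1 := by
    rw [div_mul_eq_mul_div, div_le_one hKpos]
    exact hK1
  linarith
end

section
/- Let n ≥ 1 and let λ_1 ≥ λ_2 ≥ … ≥ λ_n be real numbers with 0 ≤ λ_k ≤ 1 for all k. Let s = Σ_{k=1}^n λ_k and let K be an integer with 1 ≤ K ≤ n and s ≤ K ≤ s + 1. Then Σ_{k=1}^n λ_k (1 − λ_k) ≥ K − Σ_{k=1}^K λ_k − 1. -/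
open Finset

/-- Key eigenvalue inequality: if `1 ≥ λ_1 ≥ … ≥ λ_n ≥ 0`, `s = Σ_k λ_k`, and
`K` is an integer with `1 ≤ K ≤ n` and `s ≤ K ≤ s + 1`, then
`Σ_{k=1}^n λ_k(1−λ_k) ≥ K − Σ_{k=1}^K λ_k − 1`. -/
theorem eigenvalue_partial_sum_ineq
    (n K : ℕ) (hn : 1 ≤ n) (lam : ℕ → ℝ)
    (hdec : ∀ i j, i ≤ j → j < n → lam j ≤ lam i)
    (h01 : ∀ k, k < n → 0 ≤ lam k ∧ lam k ≤ 1)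
    (hK1 : 1 ≤ K) (hKn : K ≤ n)
    (hsK : ∑ k ∈ Finset.range n, lam k ≤ (K : ℝ))
    (hKs : (K : ℝ) ≤ (∑ k ∈ Finset.range n, lam k) + 1) :
    (K : ℝ) - (∑ k ∈ Finset.range K, lam k) - 1
      ≤ ∑ k ∈ Finset.range n, lam k * (1 - lam k) := by
  set t := lam (K - 1)
  obtain ⟨ht0, ht1⟩ : 0 ≤ t ∧ t ≤ 1 := h01 (K - 1) (by omega)
  have htop : ∑ k ∈ Finset.range K, t * (1 - lam k)
      ≤ ∑ k ∈ Finset.range K, lam k * (1 - lam k) := by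
    refine Finset.sum_le_sum fun k hk => ?_
    have hkK : k < K := Finset.mem_range.mp hk
    exact mul_le_mul_of_nonneg_right (hdec k (K - 1) (by omega) (by omega))
      (sub_nonneg.mpr (h01 k (by omega)).2)
  have htail : ∑ k ∈ Finset.Ico K n, lam k * (1 - t)
      ≤ ∑ k ∈ Finset.Ico K n, lam k * (1 - lam k) := by
    refine Finset.sum_le_sum fun k hk => ?_
    obtain ⟨hKk, hkn⟩ := Finset.mem_Ico.mp hk
    exact mul_le_mul_of_nonneg_left (sub_le_sub_left (hdec (K - 1) k (by omega) hkn) 1)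
      (h01 k hkn).1
  rw [← Finset.mul_sum, Finset.sum_sub_distrib, Finset.sum_const, Finset.card_range,
    nsmul_eq_mul, mul_one] at htop
  rw [← Finset.sum_mul] at htail
  rw [← Finset.sum_range_add_sum_Ico _ hKn] at hKs ⊢
  nlinarith [mul_nonneg (sub_nonneg.mpr hKs) (sub_nonneg.mpr ht1)]
end
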